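/- Fix a classifier g and suppose the divergence measure d(·||·) is jointly convex in its two arguments. Then for all thresholds Δ₁, Δ₂ (for which the corresponding constraint sets are nonempty) and all λ ∈ [0,1], one has λ T(Δ₁) + (1−λ) T(Δ₂) ≥ T(λ Δ₁ + (1−λ) Δ₂). -/

import Mathlib

open Finset

/-- A probability distribution on a finite type. -/
def IsProb {α : Type*} [Fintype α] (p : α → ℝ) : Prop :=
  (∀ a, 0 ≤ p a) ∧ ∑ a, p a = 1

/-- A joint probability distribution on the product of two finite types (curried form). -/
def IsJoint {α β : Type*} [Fintype α] [Fintype β] (p : α → β → ℝ) : Prop :=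
  (∀ a b, 0 ≤ p a b) ∧ ∑ a, ∑ b, p a b = 1

/-- A (possibly randomized) representation: a Markov kernel from `α` to `β`. -/
def IsKernel {α β : Type*} [Fintype α] [Fintype β] (f : α → β → ℝ) : Prop :=
  (∀ a b, 0 ≤ f a b) ∧ ∀ a, ∑ b, f a b = 1

/-- A conditional distribution on `β` given a point of `α`. -/
def IsCond {α β : Type*} [Fintype α] [Fintype β] (p : α → β → ℝ) : Prop :=
  ∀ a, IsProb (p a)

/-- The joint distribution on inputs and representations induced by a data
distribution `pX` and a representation kernel `f`. -/
def jointXZ {𝒳 𝒵 : Type*} [Fintype 𝒳] [Fintype 𝒵]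
    (pX : 𝒳 → ℝ) (f : 𝒳 → 𝒵 → ℝ) : 𝒳 → 𝒵 → ℝ :=
  fun x z => pX x * f x z

/-- The joint label–representation distribution on `𝒴 × 𝒵` obtained from the
conditional label distribution `pYX` and a joint input–representation
distribution `q` via the Markov chain `Y → X → Z`. -/
def jointYZ {𝒳 𝒵 𝒴 : Type*} [Fintype 𝒳] [Fintype 𝒵] [Fintype 𝒴]
    (pYX : 𝒳 → 𝒴 → ℝ) (q : 𝒳 → 𝒵 → ℝ) : 𝒴 → 𝒵 → ℝ :=
  fun y z => ∑ x, pYX x y * q x z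

/-- The seen-domain classification risk under a joint input–representation
distribution `q`, classifier `g`, loss `ℓ` and labeling function `ys`. -/
def risk {𝒳 𝒵 𝒴 : Type*} [Fintype 𝒳] [Fintype 𝒵] [Fintype 𝒴]
    (q : 𝒳 → 𝒵 → ℝ) (g : 𝒵 → 𝒴) (ℓ : 𝒴 → 𝒴 → ℝ) (ys : 𝒳 → 𝒴) : ℝ :=
  ∑ x, ∑ z, q x z * ℓ (g z) (ys x)

/-- The Markov kernels are the convex hull of the deterministic ones. -/
lemma setOf_isKernel_eq_convexHull {α β : Type*} [Fintype α] [Fintype β] [DecidableEq β] :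
    {f : α → β → ℝ | IsKernel f} =
      convexHull ℝ (Set.univ.pi fun _ : α => Set.range fun b : β => Pi.single b (1 : ℝ)) := by
  rw [convexHull_pi]
  ext f
  simp only [convexHull_rangle_single_eq_stdSimplex, Set.mem_pi,
    Set.mem_univ, true_implies, stdSimplex, Set.mem_ofPred_eq, IsKernel, forall_and]

/-- The set of Markov kernels is convex. -/
lemma convex_setOf_isKernel {α β : Type*} [Fintype α] [Fintype β] :
    Convex ℝ {f : α → β → ℝ | IsKernel f} := by
  classical
  rw [setOf_isKernel_eq_convexHull]
  exact convex_convexHull ℝ _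

/-- A real-valued convex function on Markov kernels is bounded above. -/
lemma ConvexOn.bddAbove_image_isKernel {α β : Type*} [Fintype α] [Fintype β]
    {F : (α → β → ℝ) → ℝ} (hF : ConvexOn ℝ {f | IsKernel f} F) :
    BddAbove (F '' {f | IsKernel f}) := by
  classical
  have hfin : (Set.univ.pi fun _ : α => Set.range fun b : β => Pi.single b (1 : ℝ)).Finite :=
    Set.Finite.pi fun _ => Set.finite_range _
  rw [setOf_isKernel_eq_convexHull] at hF ⊢
  exact hF.bddAbove_convexHull (subset_convexHull ℝ _) (hfin.image F).bddAbove

/-- A real-valued convex function on Markov kernels is bounded below. -/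
lemma ConvexOn.bddBelow_image_isKernel {α β : Type*} [Fintype α] [Fintype β] [Nonempty β]
    {F : (α → β → ℝ) → ℝ} (hF : ConvexOn ℝ {f | IsKernel f} F) :
    BddBelow (F '' {f | IsKernel f}) := by
  obtain ⟨M, hM⟩ := hF.bddAbove_image_isKernel
  set n : ℝ := (Fintype.card β : ℝ) with hn_def
  have hn : 0 < n := Nat.cast_pos.2 Fintype.card_pos
  set c : α → β → ℝ := fun _ _ => 1 / n
  refine ⟨(n + 1) * F c - n * M, ?_⟩
  rintro _ ⟨p, hp, rfl⟩
  -- The uniform kernel lies strictly between `p` and another kernel `q`.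
  set q : α → β → ℝ := fun a b => (1 / n) * ((n + 1) / n - p a b)
  have hq : IsKernel q := by
    refine ⟨fun a b => ?_, fun a => ?_⟩
    · have hle : p a b ≤ 1 := by
        rw [← hp.2 a]
        exact Finset.single_le_sum (fun b _ => hp.1 a b) (Finset.mem_univ b)
      have h1 : 1 ≤ (n + 1) / n := by
        rw [le_div_iff₀ hn]
        linarith
      exact mul_nonneg (by positivity) (by linarith)
    · simp only [q, ← Finset.mul_sum, Finset.sum_sub_distrib, hp.2 a, Finset.sum_const,
        Finset.card_univ, nsmul_eq_mul, ← hn_def]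
      field_simp
      ring
  have hc : (1 / (n + 1)) • p + (n / (n + 1)) • q = c := by
    funext a b
    simp only [Pi.add_apply, Pi.smul_apply, smul_eq_mul, q, c]
    field_simp
    ring
  have hconv := hF.2 hp hq (by positivity : 0 ≤ 1 / (n + 1))
    (by positivity : 0 ≤ n / (n + 1)) (by field_simp; ring)
  have hqM : F q ≤ M := hM ⟨q, hq, rfl⟩
  rw [hc, smul_eq_mul, smul_eq_mul, div_mul_eq_mul_div, div_mul_eq_mul_div, ← add_div,
    le_div_iff₀ (by positivity)] at hconv
  nlinarith

/-- The label–representation distribution induced by a kernel is a joint distribution. -/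
lemma isJoint_jointYZ {𝒳 𝒵 𝒴 : Type*} [Fintype 𝒳] [Fintype 𝒵] [Fintype 𝒴]
    {pX : 𝒳 → ℝ} (hpX : IsProb pX) {pYX : 𝒳 → 𝒴 → ℝ} (hpYX : IsCond pYX)
    {f : 𝒳 → 𝒵 → ℝ} (hf : IsKernel f) : IsJoint (jointYZ pYX (jointXZ pX f)) := by
  refine ⟨fun y z => Finset.sum_nonneg fun x _ =>
    mul_nonneg ((hpYX x).1 y) (mul_nonneg (hpX.1 x) (hf.1 x z)), ?_⟩
  calc ∑ y, ∑ z, jointYZ pYX (jointXZ pX f) y z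
      = ∑ y, ∑ x, ∑ z, pYX x y * (pX x * f x z) :=
        Finset.sum_congr rfl fun y _ => Finset.sum_comm
    _ = ∑ x, ∑ y, pYX x y * pX x := by
        rw [Finset.sum_comm]
        simp only [← Finset.mul_sum, hf.2, mul_one]
    _ = 1 := by simp only [← Finset.sum_mul, (hpYX _).2, one_mul, hpX.2]

/-- The induced label–representation distribution is affine in the kernel. -/
lemma jointYZ_jointXZ_smul_add_smul {𝒳 𝒵 𝒴 : Type*} [Fintype 𝒳] [Fintype 𝒵] [Fintype 𝒴]
    (pX : 𝒳 → ℝ) (pYX : 𝒳 → 𝒴 → ℝ) (f₁ f₂ : 𝒳 → 𝒵 → ℝ) (a b : ℝ) :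
    jointYZ pYX (jointXZ pX (a • f₁ + b • f₂)) = fun y z =>
      a * jointYZ pYX (jointXZ pX f₁) y z + b * jointYZ pYX (jointXZ pX f₂) y z := by
  funext y z
  simp only [jointYZ, jointXZ, Pi.add_apply, Pi.smul_apply, smul_eq_mul, Finset.mul_sum,
    ← Finset.sum_add_distrib]
  exact Finset.sum_congr rfl fun x _ => by ring

/-- The classification risk is affine in the kernel. -/
lemma risk_jointXZ_smul_add_smul {𝒳 𝒵 𝒴 : Type*} [Fintype 𝒳] [Fintype 𝒵] [Fintype 𝒴]
    (pX : 𝒳 → ℝ) (g : 𝒵 → 𝒴) (ℓ : 𝒴 → 𝒴 → ℝ) (ys : 𝒳 → 𝒴) (f₁ f₂ : 𝒳 → 𝒵 → ℝ) (a b : ℝ) :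
    risk (jointXZ pX (a • f₁ + b • f₂)) g ℓ ys =
      a * risk (jointXZ pX f₁) g ℓ ys + b * risk (jointXZ pX f₂) g ℓ ys := by
  simp only [risk, jointXZ, Pi.add_apply, Pi.smul_apply, smul_eq_mul, Finset.mul_sum,
    ← Finset.sum_add_distrib]
  exact Finset.sum_congr rfl fun x _ => Finset.sum_congr rfl fun z _ => by ring

/-- A jointly convex divergence gives a discrepancy that is convex in the kernel. -/
lemma convexOn_discrepancy {𝒳 𝒵 𝒴 : Type*} [Fintype 𝒳] [Fintype 𝒵] [Fintype 𝒴]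
    {pSX pUX : 𝒳 → ℝ} (hpS : IsProb pSX) (hpU : IsProb pUX)
    {pSYX pUYX : 𝒳 → 𝒴 → ℝ} (hpSY : IsCond pSYX) (hpUY : IsCond pUYX)
    {d : (𝒴 → 𝒵 → ℝ) → (𝒴 → 𝒵 → ℝ) → ℝ}
    (hd : ∀ a₁ a₂ b₁ b₂ : 𝒴 → 𝒵 → ℝ, IsJoint a₁ → IsJoint a₂ → IsJoint b₁ →
      IsJoint b₂ → ∀ lam : ℝ, 0 ≤ lam → lam ≤ 1 →
        d (fun y z => lam * a₁ y z + (1 - lam) * a₂ y z)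
          (fun y z => lam * b₁ y z + (1 - lam) * b₂ y z)
          ≤ lam * d a₁ b₁ + (1 - lam) * d a₂ b₂) :
    ConvexOn ℝ {f : 𝒳 → 𝒵 → ℝ | IsKernel f} fun f =>
      d (jointYZ pUYX (jointXZ pUX f)) (jointYZ pSYX (jointXZ pSX f)) := by
  refine ⟨convex_setOf_isKernel, fun f₁ hf₁ f₂ hf₂ a b ha hb hab => ?_⟩
  obtain rfl : b = 1 - a := by linarith
  simp only [jointYZ_jointXZ_smul_add_smul, smul_eq_mul]
  exact hd _ _ _ _ (isJoint_jointYZ hpU hpUY hf₁) (isJoint_jointYZ hpU hpUY hf₂)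
    (isJoint_jointYZ hpS hpSY hf₁) (isJoint_jointYZ hpS hpSY hf₂) a ha (by linarith)

/-- **Convexity of the classification risk–domain discrepancy function.**
For a fixed classifier `g`, if the divergence `d` is jointly convex in its two
arguments, then for all thresholds `Δ₁, Δ₂` whose constraint sets are nonempty
and all `λ ∈ [0,1]`, `λ T(Δ₁) + (1−λ) T(Δ₂) ≥ T(λ Δ₁ + (1−λ) Δ₂)`. -/
theorem tradeoff_T_convex
    {𝒳 𝒵 𝒴 : Type*} [Fintype 𝒳] [Fintype 𝒵] [Fintype 𝒴]
    (pSX pUX : 𝒳 → ℝ) (hpS : IsProb pSX) (hpU : IsProb pUX)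
    (pSYX pUYX : 𝒳 → 𝒴 → ℝ) (hpSY : IsCond pSYX) (hpUY : IsCond pUYX)
    (g : 𝒵 → 𝒴) (ℓ : 𝒴 → 𝒴 → ℝ) (hℓ : ∀ y y', 0 ≤ ℓ y y') (ys : 𝒳 → 𝒴)
    (d : (𝒴 → 𝒵 → ℝ) → (𝒴 → 𝒵 → ℝ) → ℝ)
    (hd : ∀ a₁ a₂ b₁ b₂ : 𝒴 → 𝒵 → ℝ, IsJoint a₁ → IsJoint a₂ → IsJoint b₁ →
      IsJoint b₂ → ∀ lam : ℝ, 0 ≤ lam → lam ≤ 1 →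
        d (fun y z => lam * a₁ y z + (1 - lam) * a₂ y z)
          (fun y z => lam * b₁ y z + (1 - lam) * b₂ y z)
          ≤ lam * d a₁ b₁ + (1 - lam) * d a₂ b₂)
    (T : ℝ → ℝ)
    (hT : ∀ Δ : ℝ, T Δ = sInf {r : ℝ | ∃ f : 𝒳 → 𝒵 → ℝ, IsKernel f ∧
      risk (jointXZ pSX f) g ℓ ys ≤ Δ ∧
      r = d (jointYZ pUYX (jointXZ pUX f)) (jointYZ pSYX (jointXZ pSX f))}) :
    ∀ Δ₁ Δ₂ lam : ℝ, 0 ≤ lam → lam ≤ 1 →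
      (∃ f : 𝒳 → 𝒵 → ℝ, IsKernel f ∧ risk (jointXZ pSX f) g ℓ ys ≤ Δ₁) →
      (∃ f : 𝒳 → 𝒵 → ℝ, IsKernel f ∧ risk (jointXZ pSX f) g ℓ ys ≤ Δ₂) →
      lam * T Δ₁ + (1 - lam) * T Δ₂ ≥ T (lam * Δ₁ + (1 - lam) * Δ₂) := by
  intro Δ₁ Δ₂ lam h0 h1 ⟨f₁, hf₁, hr₁⟩ ⟨f₂, hf₂, hr₂⟩
  have hF := convexOn_discrepancy hpS hpU hpSY hpUY hd
  have h𝒳 : Nonempty 𝒳 := by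
    by_contra h
    rw [not_nonempty_iff] at h
    simpa using hpS.2
  have h𝒵 : Nonempty 𝒵 := by
    by_contra h
    rw [not_nonempty_iff] at h
    simpa using hf₁.2 h𝒳.some
  obtain ⟨m, hm⟩ := hF.bddBelow_image_isKernel
  rw [hT, hT, hT]
  have hne : ∀ {Δ f}, IsKernel f → risk (jointXZ pSX f) g ℓ ys ≤ Δ →
      {r : ℝ | ∃ f : 𝒳 → 𝒵 → ℝ, IsKernel f ∧ risk (jointXZ pSX f) g ℓ ys ≤ Δ ∧
        r = d (jointYZ pUYX (jointXZ pUX f)) (jointYZ pSYX (jointXZ pSX f))}.Nonempty :=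
    fun hf hr => ⟨_, _, hf, hr, rfl⟩
  refine le_of_forall_pos_le_add fun ε hε => ?_
  obtain ⟨_, ⟨k₁, hk₁, hkr₁, rfl⟩, hlt₁⟩ :=
    Real.lt_sInf_add_pos (hne hf₁ hr₁) hε
  obtain ⟨_, ⟨k₂, hk₂, hkr₂, rfl⟩, hlt₂⟩ :=
    Real.lt_sInf_add_pos (hne hf₂ hr₂) hε
  have h1' : 0 ≤ 1 - lam := by linarith
  have hmix := hF.2 hk₁ hk₂ h0 h1' (by ring)
  simp only [smul_eq_mul] at hmix
  refine le_trans (csInf_le ⟨m, ?_⟩ ?_) (hmix.trans ?_)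
  · rintro _ ⟨f, hf, -, rfl⟩
    exact hm ⟨f, hf, rfl⟩
  · refine ⟨lam • k₁ + (1 - lam) • k₂, hF.1 hk₁ hk₂ h0 h1' (by ring), ?_, rfl⟩
    rw [risk_jointXZ_smul_add_smul]
    exact add_le_add (mul_le_mul_of_nonneg_left hkr₁ h0) (mul_le_mul_of_nonneg_left hkr₂ h1')
  · have e₁ := mul_le_mul_of_nonneg_left hlt₁.le h0
    have e₂ := mul_le_mul_of_nonneg_left hlt₂.le h1'
    linarith
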